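/- Let G be a finite group and A a finite set of size at least 2, and let τ : A^G → A^G be a G-equivariant map. Then τ is von Neumann regular in the monoid of all G-equivariant self-maps of A^G (i.e. there exists a G-equivariant σ : A^G → A^G with τ(σ(τ x)) = τ x for all x) if and only if for every y in the image of τ there exists x ∈ A^G with τ(x) = y and G_x = G_y. -/

import Mathlib

/-- The right action of `G` on the configuration space `A^G`:
`(x · g)(h) = x (h * g⁻¹)`. -/
def confShift {G A : Type*} [Group G] (x : G → A) (g : G) : G → A :=
  fun h => x (h * g⁻¹)

/-- A self-map of `A^G` is `G`-equivariant if it commutes with the shift action. -/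
def Equivariant {G A : Type*} [Group G] (τ : (G → A) → (G → A)) : Prop :=
  ∀ (x : G → A) (g : G), τ (confShift x g) = confShift (τ x) g

/-- The stabiliser of a configuration `x ∈ A^G`: `{g ∈ G : x · g = x}`. -/
def confStab {G A : Type*} [Group G] (x : G → A) : Set G :=
  {g : G | confShift x g = x}

theorem confShift_mul {G A : Type*} [Group G] (x : G → A) (g h : G) :
    confShift x (g * h) = confShift (confShift x g) h := by
  funext k
  simp [confShift, mul_assoc]

theorem confShift_one {G A : Type*} [Group G] (x : G → A) : confShift x 1 = x := by
  funext k
  simp [confShift]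

theorem confShift_eq_of_stab {G A : Type*} [Group G] {r s : G → A}
    (hs : confStab r ⊆ confStab s) {a b : G} (h : confShift r a = confShift r b) :
    confShift s a = confShift s b := by
  have h1 : a * b⁻¹ ∈ confStab r := by
    change confShift r (a * b⁻¹) = r
    rw [confShift_mul, h, ← confShift_mul, mul_inv_cancel, confShift_one]
  have h2 : confShift s (a * b⁻¹) = s := hs h1
  calc confShift s a = confShift (confShift s (a * b⁻¹)) b := by
        rw [← confShift_mul, inv_mul_cancel_right]
    _ = _ := by rw [h2]

/-- Orbit equivalence of configurations. -/
def confOrb (G A : Type*) [Group G] : Setoid (G → A) where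
  r x y := ∃ g, y = confShift x g
  iseqv := by
    refine ⟨fun x => ⟨1, (confShift_one x).symm⟩, ?_, ?_⟩
    · rintro x y ⟨g, rfl⟩
      exact ⟨g⁻¹, by rw [← confShift_mul, mul_inv_cancel, confShift_one]⟩
    · rintro x y z ⟨g, rfl⟩ ⟨h, rfl⟩
      exact ⟨g * h, by rw [confShift_mul]⟩

/-- for finite `G` and finite `A` of size at least 2, a `G`-equivariant
`τ : A^G → A^G` is von Neumann regular in the monoid of `G`-equivariant self-maps
iff every `y` in the image of `τ` has a preimage `x` with `G_x = G_y`. -/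
theorem stmt_8 {G A : Type*} [Group G] [Finite G] [Finite A] [Nontrivial A]
    (τ : (G → A) → (G → A)) (hτ : Equivariant τ) :
    (∃ σ : (G → A) → (G → A), Equivariant σ ∧ ∀ x : G → A, τ (σ (τ x)) = τ x) ↔
      ∀ y ∈ Set.range τ, ∃ x : G → A, τ x = y ∧ confStab x = confStab y := by
  constructor
  · rintro ⟨σ, hσ, h⟩ y ⟨z, rfl⟩
    refine ⟨σ (τ z), h z, Set.Subset.antisymm ?_ ?_⟩
    · intro g hg
      have hg' : confShift (σ (τ z)) g = σ (τ z) := hg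
      change confShift (τ z) g = τ z
      rw [← h z, ← hτ, hg']
    · intro g hg
      have hg' : confShift (τ z) g = τ z := hg
      change confShift (σ (τ z)) g = σ (τ z)
      rw [← hσ, hg']
  · intro H
    have H' : ∀ y : G → A, ∃ x : G → A, (y ∈ Set.range τ → τ x = y) ∧
        confStab y ⊆ confStab x := by
      intro y
      by_cases hy : y ∈ Set.range τ
      · obtain ⟨x, hx, hs⟩ := H y hy
        exact ⟨x, fun _ => hx, hs.ge⟩
      · exact ⟨y, fun h => absurd h hy, subset_rfl⟩
    choose F hF hS using H'
    let rep : (G → A) → (G → A) := fun y => (Quotient.mk (confOrb G A) y).out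
    have hrep : ∀ y, ∃ g, y = confShift (rep y) g := fun y =>
      Quotient.mk_out (s := confOrb G A) y
    choose γ hγ using hrep
    have hinv : ∀ y g, rep (confShift y g) = rep y := fun y g =>
      congrArg Quotient.out (Quotient.sound (s := confOrb G A)
        ((confOrb G A).symm ⟨g, rfl⟩))
    refine ⟨fun y => confShift (F (rep y)) (γ y), ?_, ?_⟩
    · intro y g
      change confShift (F (rep (confShift y g))) _ = confShift (confShift _ _) g
      rw [hinv, ← confShift_mul]
      apply confShift_eq_of_stab (hS (rep y))
      rw [confShift_mul, ← hγ y]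
      have := hγ (confShift y g)
      rw [hinv] at this
      exact this.symm
    · intro x
      change τ (confShift _ _) = _
      have hr : rep (τ x) ∈ Set.range τ := by
        refine ⟨confShift x (γ (τ x))⁻¹, ?_⟩
        rw [hτ]
        have e := congrArg (fun z => confShift z (γ (τ x))⁻¹) (hγ (τ x))
        refine Eq.trans e ?_
        change confShift (confShift _ _) _ = _
        rw [← confShift_mul, mul_inv_cancel, confShift_one]
      rw [hτ, hF _ hr, ← hγ]
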